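/- arXiv:math/0112274 — 2 statements merged into one kernel-verified Lean document; each statement's English description precedes it below -/
import Mathlib

section
/- Let T be a strictly singular bounded linear operator on an infinite dimensional Banach space X, let W be an infinite dimensional linear submanifold of X, and let (ε_i)_{i∈ℕ} be a sequence of positive reals. Then there exists a normalized basic sequence (z_i)_{i∈ℕ} in W with basis constant at most 2 such that ‖T z_i‖ ≤ ε_i for all i ∈ ℕ. -/
/-- A bounded linear operator `T` on a normed space `X` is strictly singular if for every
infinite dimensional closed subspace `Y` of `X`, the restriction of `T` to `Y` is not
bounded below. -/
def StrictlySingular {X : Type*} [NormedAddCommGroup X] [NormedSpace ℝ X]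
    (T : X →L[ℝ] X) : Prop :=
  ∀ Y : Submodule ℝ X, IsClosed (Y : Set X) → ¬ FiniteDimensional ℝ Y →
    ¬ ∃ c : ℝ, 0 < c ∧ ∀ y ∈ Y, c * ‖y‖ ≤ ‖T y‖


lemma aux_norming {X : Type*} [NormedAddCommGroup X] [NormedSpace ℝ X]
    (F : Submodule ℝ X) [FiniteDimensional ℝ F] :
    ∃ (t : Finset F) (g : X →ₗ[ℝ] (t → ℝ)), ∀ y ∈ F, ∀ k, g k = 0 → ‖y‖ ≤ 2 * ‖y + k‖ := by
  classical
  have : ProperSpace F := FiniteDimensional.proper ℝ F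
  obtain ⟨t, ht, hc⟩ := (isCompact_sphere (0 : F) 1).elim_nhds_subcover
    (fun x => Metric.ball x (1/2)) (fun x _ => Metric.ball_mem_nhds x (by norm_num))
  have hf : ∀ x : F, ∃ f : X →L[ℝ] ℝ, ‖f‖ ≤ 1 ∧ f (x : X) = ‖(x : X)‖ := fun x => by
    obtain ⟨f, h1, h2⟩ := exists_dual_vector'' ℝ (x : X)
    exact ⟨f, h1, by simpa using h2⟩
  choose f hf1 hf2 using hf
  refine ⟨t, LinearMap.pi (fun i => (f i : X →ₗ[ℝ] ℝ)), ?_⟩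
  have key : ∀ y ∈ F, ‖y‖ = 1 → ∀ k, (∀ x ∈ t, f x k = 0) → 1 ≤ 2 * ‖y + k‖ := by
    intro y hy hy1 k hk
    have hm : (⟨y, hy⟩ : F) ∈ Metric.sphere (0 : F) 1 := by simpa using hy1
    have := hc hm
    simp only [Set.mem_iUnion, Metric.mem_ball, dist_eq_norm] at this
    obtain ⟨x, hx, hd⟩ := this
    have hx1 : ‖(x : X)‖ = 1 := by simpa using ht x hx
    have hd' : ‖y - x‖ < 1/2 := hd
    have hb : ∀ v, |f x v| ≤ ‖v‖ := fun v => by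
      have := (f x).le_of_opNorm_le (hf1 x) v
      simpa using this
    have e1 := (abs_le.1 (hb (y - x))).1
    have e2 := (abs_le.1 (hb (y + k))).2
    rw [map_sub, hf2, hx1] at e1
    rw [map_add, hk x hx] at e2
    linarith
  intro y hy k hk
  have hk' : ∀ x ∈ t, f x k = 0 := fun x hx => by
    have := congrFun hk ⟨x, hx⟩
    simpa using this
  by_cases h0 : y = 0
  · subst h0; simp
  have hp : 0 < ‖y‖ := norm_pos_iff.2 h0
  have := key (‖y‖⁻¹ • y) (F.smul_mem _ hy) (by rw [norm_smul]; simp [hp.ne'])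
    (‖y‖⁻¹ • k) (fun x hx => by simp [hk' x hx])
  rw [← smul_add, norm_smul, norm_inv, norm_norm] at this
  have h3 := mul_le_mul_of_nonneg_left this hp.le
  have h4 : ‖y‖ * (2 * (‖y‖⁻¹ * ‖y + k‖)) = 2 * ‖y + k‖ := by field_simp
  linarith

lemma aux_codim {X : Type*} [AddCommGroup X] [Module ℝ X] {E : Type*} [AddCommGroup E]
    [Module ℝ E] [FiniteDimensional ℝ E] (V : Submodule ℝ X) (hV : ¬ FiniteDimensional ℝ V)
    (g : X →ₗ[ℝ] E) : ¬ FiniteDimensional ℝ (V ⊓ LinearMap.ker g : Submodule ℝ X) := by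
  intro h
  apply hV
  rw [← Submodule.fg_iff_finiteDimensional] at h ⊢
  refine Submodule.fg_of_fg_map_of_fg_inf_ker g ?_ h
  exact IsNoetherian.noetherian _

lemma aux_small {X : Type*} [NormedAddCommGroup X] [NormedSpace ℝ X] (T : X →L[ℝ] X)
    (hT : StrictlySingular T) (V : Submodule ℝ X) (hV : ¬ FiniteDimensional ℝ V)
    (e : ℝ) (he : 0 < e) : ∃ z ∈ V, ‖z‖ = 1 ∧ ‖T z‖ ≤ e := by
  by_contra! hcon
  refine hT V.topologicalClosure V.isClosed_topologicalClosure ?_ ⟨e, he, ?_⟩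
  · intro h
    exact hV (Submodule.finiteDimensional_of_le V.le_topologicalClosure)
  · have hcl : IsClosed {y : X | e * ‖y‖ ≤ ‖T y‖} :=
      isClosed_le (by fun_prop) (by fun_prop)
    have hsub : (V : Set X) ⊆ {y : X | e * ‖y‖ ≤ ‖T y‖} := by
      intro y hy
      by_cases h0 : y = 0
      · subst h0; simp
      have hp : 0 < ‖y‖ := norm_pos_iff.2 h0
      have := hcon (‖y‖⁻¹ • y) (V.smul_mem _ hy) (by rw [norm_smul]; simp [hp.ne'])
      rw [map_smul, norm_smul, norm_inv, norm_norm, inv_mul_eq_div, lt_div_iff₀ hp] at this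
      exact this.le
    intro y hy
    exact closure_minimal hsub hcl hy

theorem stmt_5 {X : Type*} [NormedAddCommGroup X] [NormedSpace ℝ X] [CompleteSpace X]
    (hX : ¬ FiniteDimensional ℝ X) (T : X →L[ℝ] X)
    (hT : StrictlySingular T)
    (W : Submodule ℝ X) (hW : ¬ FiniteDimensional ℝ W)
    (ε : ℕ → ℝ) (hε : ∀ i, 0 < ε i) :
    ∃ z : ℕ → X, (∀ i, z i ∈ W) ∧ (∀ i, ‖z i‖ = 1) ∧
      (∀ (a : ℕ → ℝ) (m n : ℕ), m ≤ n →
        ‖∑ i ∈ Finset.range m, a i • z i‖ ≤ 2 * ‖∑ i ∈ Finset.range n, a i • z i‖) ∧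
      ∀ i, ‖T (z i)‖ ≤ ε i := by
  let S := {p : Submodule ℝ X × Submodule ℝ X // FiniteDimensional ℝ p.1 ∧
    ¬ FiniteDimensional ℝ p.2 ∧ p.2 ≤ W ∧ ∀ y ∈ p.1, ∀ k ∈ p.2, ‖y‖ ≤ 2 * ‖y + k‖}
  have step : ∀ (n : ℕ) (s : S), ∃ (z : X) (s' : S), z ∈ s.1.2 ∧ ‖z‖ = 1 ∧ ‖T z‖ ≤ ε n ∧
      s.1.1 ≤ s'.1.1 ∧ z ∈ s'.1.1 ∧ s'.1.2 ≤ s.1.2 := by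
    rintro n ⟨⟨F, V⟩, hF, hV, hVW, -⟩
    obtain ⟨z, hz, hz1, hz2⟩ := aux_small T hT V hV (ε n) (hε n)
    have : FiniteDimensional ℝ F := hF
    obtain ⟨t, g, hg⟩ := aux_norming (F ⊔ Submodule.span ℝ {z})
    refine ⟨z, ⟨⟨F ⊔ Submodule.span ℝ {z}, V ⊓ LinearMap.ker g⟩, inferInstance,
      aux_codim V hV g, inf_le_left.trans hVW, ?_⟩, hz, hz1, hz2, le_sup_left, ?_, inf_le_left⟩
    · intro y hy k hk
      exact hg y hy k hk.2
    · exact (le_sup_right : Submodule.span ℝ {z} ≤ F ⊔ Submodule.span ℝ {z})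
        (Submodule.mem_span_singleton_self z)
  choose Z N h1 h2 h3 h4 h5 h6 using step
  let s0 : S := ⟨⟨⊥, W⟩, inferInstance, hW, le_rfl, by
    intro y hy k _
    rw [Submodule.mem_bot] at hy
    subst hy
    simp⟩
  let s : ℕ → S := fun n => Nat.rec s0 (fun n s => N n s) n
  have hF : Monotone fun n => (s n).1.1 := monotone_nat_of_le_succ fun n => h4 n (s n)
  have hV : Antitone fun n => (s n).1.2 := antitone_nat_of_succ_le fun n => h6 n (s n)
  refine ⟨fun n => Z n (s n), fun i => (s i).2.2.2.1 (h1 i (s i)), fun i => h2 i (s i), ?_,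
    fun i => h3 i (s i)⟩
  intro a m n hmn
  rw [← Finset.sum_range_add_sum_Ico _ hmn]
  refine (s m).2.2.2.2 _ (Submodule.sum_mem _ fun i hi => Submodule.smul_mem _ _ ?_) _
    (Submodule.sum_mem _ fun i hi => Submodule.smul_mem _ _ ?_)
  · exact hF (Nat.succ_le_of_lt (Finset.mem_range.1 hi)) (h5 i (s i))
  · exact hV (Finset.mem_Ico.1 hi).1 (h1 i (s i))
end

section
/- Let T be a strictly singular, injective bounded linear operator on an infinite dimensional Banach space X. Let Y be an infinite dimensional closed subspace of X, F a finite codimensional closed subspace of X, k a positive integer, f : (0,1) → (0,1) a function with f(η) decreasing to 0 as η decreases to 0, and i₀ a nonnegative integer. Then there exists η₀ > 0 such that for every η with 0 < η ≤ η₀ there exists x ∈ Y with ‖x‖ = 1 satisfying: (a') T^{i-1} x ∈ F and ‖T^i x‖ ≤ η ‖T^{i-1} x‖ for i = 1, 2, ..., i₀ + k + 1; and (b') bc{T^{i₀} x/‖T^{i₀} x‖, T^{i₀+1} x/‖T^{i₀+1} x‖, ..., T^{i₀+k} x/‖T^{i₀+k} x‖} ≤ 1/f(η). -/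
section helpers

variable {X : Type*} [NormedAddCommGroup X] [NormedSpace ℝ X]

lemma aux_small_s11 {T : X →L[ℝ] X} (hT : StrictlySingular T) (V : Submodule ℝ X) (hV : ¬ V.FG)
    {c : ℝ} (hc : 0 < c) : ∃ y ∈ V, y ≠ 0 ∧ ‖T y‖ ≤ c * ‖y‖ := by
  by_contra hcon
  push Not at hcon
  refine hT V.topologicalClosure V.isClosed_topologicalClosure ?_ ⟨c, hc, ?_⟩
  · intro h
    exact hV ((Module.Finite.iff_fg.1 h).of_le V.le_topologicalClosure)
  · have hcl : IsClosed {y : X | c * ‖y‖ ≤ ‖T y‖} :=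
      isClosed_le (by fun_prop) (by fun_prop)
    have hsub : (V : Set X) ⊆ {y : X | c * ‖y‖ ≤ ‖T y‖} := by
      intro y hy
      by_cases h0 : y = 0
      · simp [h0]
      · exact (hcon y hy h0).le
    intro y hy
    exact closure_minimal hsub hcl hy

lemma aux_ker {W : Type*} [AddCommGroup W] [Module ℝ W] [FiniteDimensional ℝ W]
    (G : X →ₗ[ℝ] W) (V : Submodule ℝ X) (hV : ¬ V.FG) : ¬ (V ⊓ LinearMap.ker G).FG := by
  intro h
  exact hV (Submodule.fg_of_fg_map_of_fg_inf_ker G (IsNoetherian.noetherian _) h)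

lemma aux_seq {T : X →L[ℝ] X} (hT : StrictlySingular T) (hinj : Function.Injective T)
    (V : Submodule ℝ X) (hV : ¬ V.FG) {η : ℝ} (hη : 0 < η) :
    ∃ p : ℕ → X × (X →L[ℝ] ℝ),
      (∀ n, (p n).1 ∈ V ∧ ‖(p n).1‖ = 1 ∧ ‖(p n).2‖ ≤ 1 ∧ (p n).2 (p n).1 = 1 ∧
        ‖T (p n).1‖ ≤ η / 2) ∧
      (∀ m n, m < n → (p m).2 (p n).1 = 0 ∧ ‖T (p n).1‖ ≤ ‖T (p m).1‖ / 4) := by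
  apply exists_seq_of_forall_finset_exists
    (fun q : X × (X →L[ℝ] ℝ) => q.1 ∈ V ∧ ‖q.1‖ = 1 ∧ ‖q.2‖ ≤ 1 ∧ q.2 q.1 = 1 ∧
        ‖T q.1‖ ≤ η / 2)
    (fun q r => q.2 r.1 = 0 ∧ ‖T r.1‖ ≤ ‖T q.1‖ / 4)
  intro s hs
  obtain ⟨c, hc, hcη, hcs⟩ : ∃ c : ℝ, 0 < c ∧ c ≤ η / 2 ∧ ∀ q ∈ s, c ≤ ‖T q.1‖ / 4 := by
    have h1 : ∀ᶠ c in nhdsWithin (0:ℝ) (Set.Ioi 0), c ≤ η / 2 :=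
      nhdsWithin_le_nhds (eventually_le_nhds (by positivity))
    have h2 : ∀ᶠ c in nhdsWithin (0:ℝ) (Set.Ioi 0), ∀ q ∈ s, c ≤ ‖T q.1‖ / 4 := by
      rw [Filter.eventually_all_finset]
      intro q hq
      apply nhdsWithin_le_nhds (eventually_le_nhds _)
      have : T q.1 ≠ 0 := by
        rw [Ne, map_eq_zero_iff T hinj]
        intro h
        have := (hs q hq).2.1
        simp [h] at this
      positivity
    obtain ⟨c, ⟨h1, h2⟩, h3⟩ := ((h1.and h2).and self_mem_nhdsWithin).exists
    exact ⟨c, h3, h1, h2⟩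
  let G : X →ₗ[ℝ] (s → ℝ) := LinearMap.pi fun q => (q.1.2 : X →ₗ[ℝ] ℝ)
  obtain ⟨y, hyV, hy0, hy⟩ := aux_small_s11 hT _ (aux_ker G V hV) hc
  have hn : ‖y‖ ≠ 0 := norm_ne_zero_iff.2 hy0
  have hx1 : ‖‖y‖⁻¹ • y‖ = 1 := by
    rw [norm_smul, norm_inv, norm_norm, inv_mul_cancel₀ hn]
  have hTx : ‖T (‖y‖⁻¹ • y)‖ ≤ c := by
    rw [map_smul, norm_smul, norm_inv, norm_norm, inv_mul_le_iff₀ (by positivity)]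
    linarith
  obtain ⟨g, hg1, hg⟩ := exists_dual_vector'' ℝ (‖y‖⁻¹ • y)
  refine ⟨(‖y‖⁻¹ • y, g), ⟨V.smul_mem _ hyV.1, hx1, hg1, ?_, hTx.trans hcη⟩, ?_⟩
  · simpa only [hx1, RCLike.ofReal_one] using hg
  · intro q hq
    refine ⟨?_, hTx.trans (hcs q hq)⟩
    have : G y = 0 := hyV.2
    have := congrFun this ⟨q, hq⟩
    have h3 : q.2 y = 0 := this
    simp [h3]

lemma aux_coef (p : ℕ → X × (X →L[ℝ] ℝ))
    (h1 : ∀ n, ‖(p n).1‖ = 1 ∧ ‖(p n).2‖ ≤ 1 ∧ (p n).2 (p n).1 = 1)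
    (h2 : ∀ m n, m < n → (p m).2 (p n).1 = 0) (N : ℕ) (a : ℕ → ℝ) :
    ∀ n < N, |a n| ≤ 2 ^ n * ‖∑ i ∈ Finset.range N, a i • (p i).1‖ := by
  intro n
  induction n using Nat.strong_induction_on with
  | _ n ih =>
  intro hn
  set w := ∑ i ∈ Finset.range N, a i • (p i).1 with hw
  have e1 : (p n).2 w = ∑ i ∈ Finset.range n, a i * (p n).2 (p i).1 + a n := by
    rw [hw, map_sum, ← Finset.sum_subset (Finset.range_mono (Nat.succ_le_of_lt hn)),
      Finset.sum_range_succ]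
    · simp [(h1 n).2.2]
    · intro i hi hi'
      have : n < i := by simp at hi'; omega
      simp [h2 n i this]
  have e2 : |(p n).2 w| ≤ ‖w‖ := by
    have := (p n).2.le_of_opNorm_le (h1 n).2.1 w
    simpa using this
  have e3 : |∑ i ∈ Finset.range n, a i * (p n).2 (p i).1| ≤
      ∑ i ∈ Finset.range n, 2 ^ i * ‖w‖ := by
    refine (Finset.abs_sum_le_sum_abs _ _).trans (Finset.sum_le_sum fun i hi => ?_)
    have hi : i < n := by simpa using hi
    have := (p n).2.le_of_opNorm_le (h1 n).2.1 (p i).1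
    rw [(h1 i).1, Real.norm_eq_abs] at this
    rw [abs_mul]
    have h5 := ih i hi (hi.trans hn)
    nlinarith [abs_nonneg (a i)]
  rw [← Finset.sum_mul, geom_sum_eq (by norm_num)] at e3
  have : a n = (p n).2 w - ∑ i ∈ Finset.range n, a i * (p n).2 (p i).1 := by rw [e1]; ring
  rw [this]
  refine (abs_sub _ _).trans ?_
  linarith

lemma aux_sub {T : X →L[ℝ] X} (hT : StrictlySingular T) (hinj : Function.Injective T)
    (V : Submodule ℝ X) (hV : ¬ V.FG) {η : ℝ} (hη : 0 < η) :
    ∃ W : Submodule ℝ X, W ≤ V ∧ ¬ W.FG ∧ ∀ w ∈ W, ‖T w‖ ≤ η * ‖w‖ := by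
  obtain ⟨p, h1, h2⟩ := aux_seq hT hinj V hV hη
  have hco := aux_coef p (fun n => ⟨(h1 n).2.1, (h1 n).2.2.1, (h1 n).2.2.2.1⟩)
    (fun m n h => (h2 m n h).1)
  have hrep : ∀ c : ℕ →₀ ℝ, ∃ N, (∀ i, N ≤ i → c i = 0) ∧
      (c.sum fun i a => a • (p i).1) = ∑ i ∈ Finset.range N, c i • (p i).1 := by
    intro c
    have hle : ∀ i ∈ c.support, i < c.support.sup id + 1 := fun i hi =>
      Nat.lt_succ_of_le (Finset.le_sup (f := id) hi)
    refine ⟨c.support.sup id + 1, ?_, ?_⟩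
    · intro i hi
      by_contra h
      have := hle i (by simpa using h)
      omega
    · apply Finset.sum_subset
      · intro i hi; simpa using hle i hi
      · intro i _ hi
        have : c i = 0 := by simpa using hi
        simp [this]
  have hdec : ∀ n, ‖T (p n).1‖ ≤ η / 2 * (1 / 4) ^ n := by
    intro n
    induction n with
    | zero => simpa using (h1 0).2.2.2.2
    | succ n ih =>
      have := (h2 n (n+1) (Nat.lt_succ_self n)).2
      rw [pow_succ]; linarith
  refine ⟨Submodule.span ℝ (Set.range fun n => (p n).1), ?_, ?_, ?_⟩
  · rw [Submodule.span_le]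
    rintro _ ⟨n, rfl⟩
    exact (h1 n).1
  · intro hfg
    have hli : LinearIndependent ℝ (fun n => (p n).1) := by
      rw [linearIndependent_iff]
      intro c hc
      obtain ⟨N, hN, hs⟩ := hrep c
      rw [Finsupp.linearCombination_apply, hs] at hc
      ext i
      by_cases hi : i < N
      · have := hco N c i hi
        rw [hc] at this
        simpa using this
      · simpa using hN i (by omega)
    have : Module.Finite ℝ (Submodule.span ℝ (Set.range fun n => (p n).1)) :=
      Module.Finite.iff_fg.2 hfg
    have := (linearIndependent_span hli).finite_of_isNoetherian
    exact not_finite ℕ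
  · intro w hw
    rw [Finsupp.mem_span_range_iff_exists_finsupp] at hw
    obtain ⟨c, hc⟩ := hw
    obtain ⟨N, hN, hs⟩ := hrep c
    rw [hs] at hc
    have hco' := hco N c
    rw [hc] at hco'
    calc ‖T w‖ = ‖∑ i ∈ Finset.range N, c i • T (p i).1‖ := by rw [← hc]; simp
      _ ≤ ∑ i ∈ Finset.range N, ‖c i • T (p i).1‖ := norm_sum_le _ _
      _ ≤ ∑ i ∈ Finset.range N, (η / 2 * ‖w‖) * (1 / 2) ^ i := by
        refine Finset.sum_le_sum fun i hi => ?_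
        rw [norm_smul, Real.norm_eq_abs]
        calc |c i| * ‖T (p i).1‖ ≤ (2 ^ i * ‖w‖) * (η / 2 * (1 / 4) ^ i) :=
              mul_le_mul (hco' i (by simpa using hi)) (hdec i) (norm_nonneg _) (by positivity)
          _ = (η / 2 * ‖w‖) * (2 * (1 / 4)) ^ i := by rw [mul_pow]; ring
          _ = _ := by norm_num
      _ = (η / 2 * ‖w‖) * ∑ i ∈ Finset.range N, (1 / 2) ^ i := by rw [Finset.mul_sum]
      _ ≤ (η / 2 * ‖w‖) * 2 := by
        gcongr
        exact sum_geometric_two_le N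
      _ = _ := by ring

lemma aux_map {T : X →L[ℝ] X} (hinj : Function.Injective T)
    (V : Submodule ℝ X) (hV : ¬ V.FG) : ¬ (V.map (T : X →ₗ[ℝ] X)).FG :=
  fun h => hV (Submodule.fg_of_fg_map_injective (T : X →ₗ[ℝ] X) hinj h)

lemma aux_pow_inj {T : X →L[ℝ] X} (hinj : Function.Injective T) (n : ℕ) :
    Function.Injective (T ^ n : X →L[ℝ] X) := by
  induction n with
  | zero => exact fun a b h => h
  | succ n ih =>
    intro a b h
    rw [pow_succ, mul_apply_eq_comp, mul_apply_eq_comp] at h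
    exact hinj (ih h)

lemma aux_iter {T : X →L[ℝ] X} (hT : StrictlySingular T) (hinj : Function.Injective T)
    {η : ℝ} (hη : 0 < η) (N : ℕ) : ∀ (V : Submodule ℝ X), ¬ V.FG →
    ∃ W : Submodule ℝ X, W ≤ V ∧ ¬ W.FG ∧
      ∀ w ∈ W, ∀ i < N, ‖(T ^ (i + 1)) w‖ ≤ η * ‖(T ^ i) w‖ := by
  induction N with
  | zero => intro V hV; exact ⟨V, le_rfl, hV, by simp⟩
  | succ N ih =>
    intro V hV
    obtain ⟨W, hWV, hW, hWs⟩ := aux_sub hT hinj V hV hη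
    obtain ⟨U, hUW, hU, hUs⟩ := ih _ (aux_map hinj W hW)
    have hmap : (W ⊓ U.comap (T : X →ₗ[ℝ] X)).map (T : X →ₗ[ℝ] X) = U := by
      apply le_antisymm
      · rintro _ ⟨y, hy, rfl⟩
        exact hy.2
      · intro u hu
        obtain ⟨y, hy, rfl⟩ := hUW hu
        exact ⟨y, ⟨hy, hu⟩, rfl⟩
    refine ⟨W ⊓ U.comap (T : X →ₗ[ℝ] X), inf_le_left.trans hWV, ?_, ?_⟩
    · intro h
      apply hU
      rw [← hmap]
      exact h.map _
    · intro w hw i hi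
      cases i with
      | zero => simpa using hWs w hw.1
      | succ i =>
        have := hUs (T w) hw.2 i (by omega)
        simpa only [pow_succ, mul_apply_eq_comp] using this

lemma aux_biorth (n : ℕ) (v : ℕ → X) (C : ℝ) (hC : 0 < C)
    (h : ∀ β : ℕ → ℝ, ∀ j < n, |β j| * ‖v j‖ ≤ C * ‖∑ i ∈ Finset.range n, β i • v i‖)
    (j : ℕ) (hj : j < n) : ∃ φ : X →L[ℝ] ℝ, ∀ w, φ w = 0 → ∀ β : ℕ → ℝ,
      |β j| * ‖v j‖ ≤ C * ‖w + ∑ i ∈ Finset.range n, β i • v i‖ := by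
  classical
  let L : (ℕ → ℝ) →ₗ[ℝ] X := ∑ i ∈ Finset.range n,
    (LinearMap.toSpanSingleton ℝ X (v i)).comp (LinearMap.proj i)
  have hL : ∀ β, L β = ∑ i ∈ Finset.range n, β i • v i := by
    intro β; simp [L]
  let E : Submodule ℝ X := (LinearMap.ker (LinearMap.proj j : (ℕ → ℝ) →ₗ[ℝ] ℝ)).map L
  obtain ⟨g, hg1, hg⟩ := exists_dual_vector'' ℝ (Submodule.Quotient.mk (v j) : X ⧸ E)
  have hmk : ∀ x, |g (Submodule.Quotient.mk x)| ≤ ‖x‖ := by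
    intro x
    have := g.le_of_opNorm_le hg1 (Submodule.Quotient.mk x)
    rw [one_mul] at this
    exact this.trans (Submodule.Quotient.norm_mk_le E x)
  let φ : X →L[ℝ] ℝ := LinearMap.mkContinuous ((g : (X ⧸ E) →ₗ[ℝ] ℝ).comp E.mkQ) 1
    (by intro x; simpa using hmk x)
  have hφ : ∀ x, φ x = g (Submodule.Quotient.mk x) := fun x => rfl
  have hd : ‖v j‖ ≤ C * φ (v j) := by
    rw [hφ, hg]
    apply le_of_forall_pos_le_add
    intro ε hε
    obtain ⟨m, hm, hm'⟩ := Submodule.Quotient.norm_mk_lt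
      (Submodule.Quotient.mk (v j) : X ⧸ E) (div_pos hε hC)
    rw [Submodule.Quotient.eq] at hm
    obtain ⟨β, hβ, hβm⟩ := hm
    have hβ : β j = 0 := hβ
    have h3 := h (β + Pi.single j 1) j hj
    rw [← hL, map_add, hβm, hL] at h3
    have : ∑ i ∈ Finset.range n, (Pi.single j (1:ℝ) : ℕ → ℝ) i • v i = v j := by
      rw [Finset.sum_eq_single j]
      · simp
      · intro b _ hb; simp [hb]
      · intro hh; simp at hh; omega
    rw [this] at h3
    simp [hβ] at h3
    calc ‖v j‖ ≤ C * ‖m‖ := h3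
      _ ≤ C * (‖(Submodule.Quotient.mk (v j) : X ⧸ E)‖ + ε / C) := by gcongr
      _ = _ := by simp; field_simp
  refine ⟨φ, fun w hw β => ?_⟩
  have e1 : φ (w + ∑ i ∈ Finset.range n, β i • v i) = β j * φ (v j) := by
    rw [map_add, hw, zero_add]
    have : ∑ i ∈ Finset.range n, β i • v i - β j • v j ∈ E := by
      refine ⟨β - β j • Pi.single j 1, by simp, ?_⟩
      rw [map_sub, map_smul, hL, hL]
      congr 2
      rw [Finset.sum_eq_single j]
      · simp
      · intro b _ hb; simp [hb]
      · intro hh; simp at hh; omega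
    have h4 := (Submodule.Quotient.eq E).2 this
    rw [hφ, h4, ← hφ, map_smul, smul_eq_mul]
  have e2 := hmk (w + ∑ i ∈ Finset.range n, β i • v i)
  rw [← hφ, e1, abs_mul] at e2
  calc |β j| * ‖v j‖ ≤ |β j| * (C * φ (v j)) := by gcongr
    _ ≤ |β j| * (C * |φ (v j)|) := by gcongr; exact le_abs_self _
    _ = C * (|β j| * |φ (v j)|) := by ring
    _ ≤ _ := by gcongr

/-- perturbation -/
lemma aux_pert (n : ℕ) (v u : ℕ → X) (C ε : ℝ) (hC : 0 < C) (hε : 0 ≤ ε) (hε1 : ε ≤ 1)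
    (hεC : ε * (n * C) ≤ 1 / 2)
    (h : ∀ β : ℕ → ℝ, ∀ j < n, |β j| * ‖v j‖ ≤ C * ‖∑ i ∈ Finset.range n, β i • v i‖)
    (hu : ∀ j < n, ‖u j - v j‖ ≤ ε * ‖v j‖) (β : ℕ → ℝ) (j : ℕ) (hj : j < n) :
    |β j| * ‖u j‖ ≤ 4 * C * ‖∑ i ∈ Finset.range n, β i • u i‖ := by
  set S := ‖∑ i ∈ Finset.range n, β i • v i‖ with hS
  set D := ‖∑ i ∈ Finset.range n, β i • u i‖ with hD
  have h1 : S ≤ D + ∑ i ∈ Finset.range n, ε * (C * S) := by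
    have : ∑ i ∈ Finset.range n, β i • v i = ∑ i ∈ Finset.range n, β i • u i -
        ∑ i ∈ Finset.range n, β i • (u i - v i) := by
      rw [← Finset.sum_sub_distrib]; congr 1; ext i; rw [smul_sub]; abel
    have h0 : S = ‖∑ i ∈ Finset.range n, β i • u i -
        ∑ i ∈ Finset.range n, β i • (u i - v i)‖ := by rw [hS, this]
    refine h0.le.trans ?_
    refine (norm_sub_le _ _).trans (add_le_add le_rfl ((norm_sum_le _ _).trans
      (Finset.sum_le_sum fun i hi => ?_)))
    rw [norm_smul, Real.norm_eq_abs]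
    have hi : i < n := by simpa using hi
    calc |β i| * ‖u i - v i‖ ≤ |β i| * (ε * ‖v i‖) := by gcongr; exact hu i hi
      _ = ε * (|β i| * ‖v i‖) := by ring
      _ ≤ _ := mul_le_mul_of_nonneg_left (h β i hi) hε
  rw [Finset.sum_const, Finset.card_range, nsmul_eq_mul] at h1
  have hS0 : 0 ≤ S := norm_nonneg _
  have h2 : S ≤ 2 * D := by nlinarith
  have h3 : ‖u j‖ ≤ 2 * ‖v j‖ := by
    have := norm_add_le (u j - v j) (v j)
    rw [sub_add_cancel] at this
    nlinarith [hu j hj, norm_nonneg (v j)]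
  calc |β j| * ‖u j‖ ≤ |β j| * (2 * ‖v j‖) := by gcongr
    _ = 2 * (|β j| * ‖v j‖) := by ring
    _ ≤ 2 * (C * S) := mul_le_mul_of_nonneg_left (h β j hj) (by norm_num)
    _ ≤ 2 * (C * (2 * D)) := by gcongr
    _ = _ := by ring

lemma aux_main {T : X →L[ℝ] X} (hT : StrictlySingular T) (hinj : Function.Injective T) (k : ℕ) :
    ∃ C : ℝ, 0 < C ∧ ∀ (V : Submodule ℝ X), ¬ V.FG → ∀ i₀ : ℕ, ∃ x ∈ V, x ≠ 0 ∧
      ∀ β : ℕ → ℝ, ∀ j < k + 1, |β j| * ‖(T ^ (i₀ + j)) x‖ ≤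
        C * ‖∑ i ∈ Finset.range (k + 1), β i • (T ^ (i₀ + i)) x‖ := by
  induction k with
  | zero =>
    refine ⟨1, one_pos, fun V hV i₀ => ?_⟩
    obtain ⟨x, hx, hx0, -⟩ := aux_small_s11 hT V hV one_pos
    refine ⟨x, hx, hx0, fun β j hj => ?_⟩
    obtain rfl : j = 0 := by omega
    simp [norm_smul]
  | succ k ih =>
    obtain ⟨C, hC, ih⟩ := ih
    set C1 : ℝ := 1 + (k + 1 : ℕ) * C with hC1
    have hC1C : C ≤ C1 := by rw [hC1]; push_cast; nlinarith [(Nat.cast_nonneg k : (0:ℝ) ≤ k)]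
    have hC1p : 0 < C1 := hC.trans_le hC1C
    refine ⟨4 * C1, by positivity, fun V hV i₀ => ?_⟩
    obtain ⟨x, hxV, hx0, hx⟩ := ih V hV (i₀ + 1)
    have hpx : ∀ m, 0 < ‖(T ^ m) x‖ := fun m => norm_pos_iff.2 (by
      rw [Ne, map_eq_zero_iff _ (aux_pow_inj hinj m)]; exact hx0)
    choose! φ hφ using aux_biorth (k + 1) (fun i => (T ^ (i₀ + 1 + i)) x) C hC hx
    set ε : ℝ := 1 / (2 * ((k + 2 : ℕ) * C1) + 1) with hε
    have hεp : 0 < ε := by positivity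
    have hε1 : ε < 1 := by
      rw [hε, div_lt_one (by positivity)]
      have : 0 < ((k + 2 : ℕ) * C1 : ℝ) := by positivity
      linarith
    have hεC : ε * ((k + 2 : ℕ) * C1) ≤ 1 / 2 := by
      rw [hε, div_mul_eq_mul_div, div_le_iff₀ (by positivity)]
      linarith
    set M : ℝ := ‖(T ^ i₀) x‖ / ε with hM
    have hMp : 0 < M := div_pos (hpx _) hεp
    obtain ⟨δ, hδ, hδs⟩ : ∃ δ : ℝ, 0 < δ ∧ ∀ j ∈ Finset.range (k + 1),
        δ ≤ ε * ‖(T ^ (i₀ + 1 + j)) x‖ / (M * (‖T‖ + 1) ^ j) := by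
      have h2 : ∀ᶠ δ in nhdsWithin (0:ℝ) (Set.Ioi 0), ∀ j ∈ Finset.range (k + 1),
          δ ≤ ε * ‖(T ^ (i₀ + 1 + j)) x‖ / (M * (‖T‖ + 1) ^ j) := by
        rw [Filter.eventually_all_finset]
        intro q hq
        apply nhdsWithin_le_nhds (eventually_le_nhds _)
        have := hpx (i₀ + 1 + q)
        positivity
      obtain ⟨δ, h1, h2⟩ := (h2.and self_mem_nhdsWithin).exists
      exact ⟨δ, h2, h1⟩
    let G : X →ₗ[ℝ] (Fin (k + 1) → ℝ) :=
      LinearMap.pi fun q => ((φ q).comp (T ^ i₀) : X →L[ℝ] ℝ)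
    obtain ⟨_, ⟨z', hz', rfl⟩, hy0, hy⟩ := aux_small_s11 hT _
      (aux_map (aux_pow_inj hinj i₀) _ (aux_ker G V hV)) hδ
    change (T ^ i₀) z' ≠ 0 at hy0
    change ‖T ((T ^ i₀) z')‖ ≤ δ * ‖(T ^ i₀) z'‖ at hy
    set z : X := (M / ‖(T ^ i₀) z'‖) • z' with hz
    have hzV : z ∈ V := V.smul_mem _ hz'.1
    have hn : 0 < ‖(T ^ i₀) z'‖ := norm_pos_iff.2 hy0
    have hφz : ∀ j < k + 1, φ j ((T ^ i₀) z) = 0 := by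
      intro j hj
      have : G z' = 0 := hz'.2
      have : φ j ((T ^ i₀) z') = 0 := congrFun this ⟨j, hj⟩
      rw [hz, map_smul, map_smul, this, smul_zero]
    have hz0 : ‖(T ^ i₀) z‖ = M := by
      rw [hz, map_smul, norm_smul, norm_div, norm_norm, Real.norm_of_nonneg hMp.le,
        div_mul_cancel₀ _ hn.ne']
    have hz1 : ‖(T ^ (i₀ + 1)) z‖ ≤ δ * M := by
      rw [pow_succ', mul_apply_eq_comp, hz, map_smul, map_smul, norm_smul, norm_div,
        norm_norm, Real.norm_of_nonneg hMp.le]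
      calc M / ‖(T ^ i₀) z'‖ * ‖T ((T ^ i₀) z')‖ ≤
          M / ‖(T ^ i₀) z'‖ * (δ * ‖(T ^ i₀) z'‖) := by gcongr
        _ = _ := by field_simp
    have hzj : ∀ j, ‖(T ^ (i₀ + 1 + j)) z‖ ≤ (‖T‖ + 1) ^ j * (δ * M) := by
      intro j
      induction j with
      | zero => simpa using hz1
      | succ j ihj =>
        rw [← add_assoc, pow_succ', mul_apply_eq_comp]
        calc _ ≤ ‖T‖ * ‖(T ^ (i₀ + 1 + j)) z‖ := T.le_opNorm _
          _ ≤ (‖T‖ + 1) * ((‖T‖ + 1) ^ j * (δ * M)) := by gcongr; linarith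
          _ = _ := by ring
    let v : ℕ → X := fun j => if j = 0 then (T ^ i₀) z else (T ^ (i₀ + j)) x
    have hv0 : v 0 = (T ^ i₀) z := rfl
    have hvs : ∀ j, v (j + 1) = (T ^ (i₀ + 1 + j)) x := by
      intro j; simp only [v, Nat.succ_ne_zero, if_false]; congr 2; ring
    have hvbd : ∀ β : ℕ → ℝ, ∀ j < k + 2, |β j| * ‖v j‖ ≤
        C1 * ‖∑ i ∈ Finset.range (k + 2), β i • v i‖ := by
      intro β
      have hsum : ∑ i ∈ Finset.range (k + 2), β i • v i = β 0 • (T ^ i₀) z +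
          ∑ i ∈ Finset.range (k + 1), β (i + 1) • (T ^ (i₀ + 1 + i)) x := by
        rw [Finset.sum_range_succ', add_comm, hv0]
        simp only [hvs]
      set S := ‖∑ i ∈ Finset.range (k + 2), β i • v i‖ with hS
      have hS0 : 0 ≤ S := norm_nonneg _
      have hj1 : ∀ j < k + 1, |β (j + 1)| * ‖(T ^ (i₀ + 1 + j)) x‖ ≤ C * S := by
        intro j hj
        have := hφ j hj (β 0 • (T ^ i₀) z) (by rw [map_smul, hφz j hj, smul_zero])
          (fun i => β (i + 1))
        rw [hS, hsum]
        exact this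
      intro j hj
      cases j with
      | zero =>
        have e : β 0 • (T ^ i₀) z = ∑ i ∈ Finset.range (k + 2), β i • v i -
          ∑ i ∈ Finset.range (k + 1), β (i + 1) • (T ^ (i₀ + 1 + i)) x := by rw [hsum]; abel
        rw [hv0, ← Real.norm_eq_abs, ← norm_smul, e]
        refine (norm_sub_le _ _).trans ?_
        have : ‖∑ i ∈ Finset.range (k + 1), β (i + 1) • (T ^ (i₀ + 1 + i)) x‖ ≤
            ∑ i ∈ Finset.range (k + 1), C * S := by
          refine (norm_sum_le _ _).trans (Finset.sum_le_sum fun i hi => ?_)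
          rw [norm_smul, Real.norm_eq_abs]
          exact hj1 i (by simpa using hi)
        rw [Finset.sum_const, Finset.card_range, nsmul_eq_mul] at this
        rw [← hS, hC1]
        linarith
      | succ j =>
        rw [hvs]
        exact (hj1 j (by omega)).trans (by gcongr)
    have hpert := aux_pert (k + 2) v (fun j => (T ^ (i₀ + j)) (x + z)) C1 ε hC1p hεp.le hε1.le
      hεC hvbd (by
        intro j hj
        cases j with
        | zero =>
          rw [hv0, map_add, add_zero, add_sub_cancel_right, hz0, hM, mul_div_cancel₀ _ hεp.ne']
        | succ j =>
          rw [hvs, show i₀ + (j + 1) = i₀ + 1 + j by ring, map_add, add_sub_cancel_left]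
          refine (hzj j).trans ?_
          have := hδs j (by simp; omega)
          rw [le_div_iff₀ (by positivity)] at this
          linarith)
    refine ⟨x + z, V.add_mem hxV hzV, ?_, hpert⟩
    intro h0
    have h1 : z = -x := by rw [eq_neg_iff_add_eq_zero, add_comm]; exact h0
    rw [h1, map_neg, norm_neg, hM, eq_div_iff hεp.ne'] at hz0
    nlinarith [hpx i₀]

end helpers

theorem stmt_11 {X : Type*} [NormedAddCommGroup X] [NormedSpace ℝ X] [CompleteSpace X]
    (hX : ¬ FiniteDimensional ℝ X) (T : X →L[ℝ] X)
    (hT : StrictlySingular T) (hinj : Function.Injective T)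
    (Y : Submodule ℝ X) (hYc : IsClosed (Y : Set X)) (hY : ¬ FiniteDimensional ℝ Y)
    (F : Submodule ℝ X) (hFc : IsClosed (F : Set X)) (hF : FiniteDimensional ℝ (X ⧸ F))
    (k : ℕ) (hk : 0 < k)
    (f : ℝ → ℝ) (hfmem : ∀ η ∈ Set.Ioo (0 : ℝ) 1, f η ∈ Set.Ioo (0 : ℝ) 1)
    (hfmono : MonotoneOn f (Set.Ioo (0 : ℝ) 1))
    (hf0 : Filter.Tendsto f (nhdsWithin 0 (Set.Ioi 0)) (nhds 0))
    (i₀ : ℕ) :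
    ∃ η₀ ∈ Set.Ioo (0 : ℝ) 1, ∀ η : ℝ, 0 < η → η ≤ η₀ →
      ∃ x ∈ Y, ‖x‖ = 1 ∧
        (∀ i, 1 ≤ i → i ≤ i₀ + k + 1 →
          (T ^ (i - 1)) x ∈ F ∧ ‖(T ^ i) x‖ ≤ η * ‖(T ^ (i - 1)) x‖) ∧
        (∀ α : Fin (k + 1) → ℝ,
          ‖∑ j, α j • (‖(T ^ (i₀ + (j : ℕ))) x‖⁻¹ • (T ^ (i₀ + (j : ℕ))) x)‖ = 1 →
          ∀ j, |α j| ≤ 1 / f η) := by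
  obtain ⟨C, hC, hmain⟩ := aux_main hT hinj k
  have hev : ∀ᶠ η in nhdsWithin (0:ℝ) (Set.Ioi 0), f η < 1 / C :=
    hf0.eventually_lt_const (by positivity)
  have hlt : ∀ᶠ η in nhdsWithin (0:ℝ) (Set.Ioi 0), η < 1 :=
    nhdsWithin_le_nhds (eventually_lt_nhds one_pos)
  obtain ⟨η₀, ⟨hη₀f, hη₀1⟩, hη₀⟩ := ((hev.and hlt).and self_mem_nhdsWithin).exists
  have hη₀ : 0 < η₀ := hη₀
  refine ⟨η₀, ⟨hη₀, hη₀1⟩, fun η hη hle => ?_⟩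
  have hηm : η ∈ Set.Ioo (0 : ℝ) 1 := ⟨hη, hle.trans_lt hη₀1⟩
  have hfη : f η < 1 / C := (hfmono hηm ⟨hη₀, hη₀1⟩ hle).trans_lt hη₀f
  have hfp : 0 < f η := (hfmem η hηm).1
  have hCf : C ≤ 1 / f η := by
    rw [le_div_iff₀ hfp]
    rw [lt_div_iff₀ hC] at hfη
    linarith
  let G : X →ₗ[ℝ] (Fin (i₀ + k + 1) → X ⧸ F) :=
    LinearMap.pi fun q => F.mkQ.comp ((T ^ (q : ℕ) : X →L[ℝ] X) : X →ₗ[ℝ] X)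
  have hYfg : ¬ Y.FG := fun h => hY (Module.Finite.iff_fg.2 h)
  obtain ⟨W, hWY, hW, hWs⟩ := aux_iter hT hinj hη (i₀ + k + 1) _ (aux_ker G Y hYfg)
  obtain ⟨x', hx'W, hx'0, hx'⟩ := hmain W hW i₀
  have hn : 0 < ‖x'‖ := norm_pos_iff.2 hx'0
  set x : X := ‖x'‖⁻¹ • x' with hx
  have hxW : x ∈ W := W.smul_mem _ hx'W
  have hx1 : ‖x‖ = 1 := by rw [hx, norm_smul, norm_inv, norm_norm, inv_mul_cancel₀ hn.ne']
  have hx0 : x ≠ 0 := by intro h; simp [h] at hx1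
  have hpx : ∀ m, 0 < ‖(T ^ m) x‖ := fun m => norm_pos_iff.2 (by
    rw [Ne, map_eq_zero_iff _ (aux_pow_inj hinj m)]; exact hx0)
  refine ⟨x, (hWY hxW).1, hx1, ?_, ?_⟩
  · intro i hi1 hi2
    obtain ⟨i, rfl⟩ : ∃ m, i = m + 1 := ⟨i - 1, by omega⟩
    rw [Nat.add_sub_cancel]
    refine ⟨?_, hWs x hxW i (by omega)⟩
    have : G x = 0 := (hWY hxW).2
    have : F.mkQ ((T ^ i) x) = 0 := congrFun this ⟨i, by omega⟩
    simpa using this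
  · intro α hα j
    let β : ℕ → ℝ := fun i => if h : i < k + 1 then α ⟨i, h⟩ * ‖(T ^ (i₀ + i)) x‖⁻¹ else 0
    have hβ : ∀ j : Fin (k + 1), β j = α j * ‖(T ^ (i₀ + (j : ℕ))) x‖⁻¹ := by
      intro j; simp only [β, j.2, dif_pos]
    have hsum : ∑ i ∈ Finset.range (k + 1), β i • (T ^ (i₀ + i)) x' =
        ‖x'‖ • ∑ j, α j • (‖(T ^ (i₀ + (j : ℕ))) x‖⁻¹ • (T ^ (i₀ + (j : ℕ))) x) := by
      rw [Finset.sum_range, Finset.smul_sum]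
      refine Finset.sum_congr rfl fun j _ => ?_
      have : (T ^ (i₀ + (j : ℕ))) x' = ‖x'‖ • (T ^ (i₀ + (j : ℕ))) x := by
        rw [← map_smul, hx, smul_inv_smul₀ hn.ne']
      rw [hβ, this, smul_smul, smul_smul, smul_smul]
      congr 1; ring
    have h1 := hx' β j j.2
    rw [hsum, norm_smul, hα, norm_norm, mul_one, hβ] at h1
    have h2 : ‖(T ^ (i₀ + (j : ℕ))) x'‖ = ‖x'‖ * ‖(T ^ (i₀ + (j : ℕ))) x‖ := by
      have : (T ^ (i₀ + (j : ℕ))) x' = ‖x'‖ • (T ^ (i₀ + (j : ℕ))) x := by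
        rw [← map_smul, hx, smul_inv_smul₀ hn.ne']
      rw [this, norm_smul, norm_norm]
    have hpj := hpx (i₀ + (j : ℕ))
    have h3 : |α j * ‖(T ^ (i₀ + (j : ℕ))) x‖⁻¹| * ‖(T ^ (i₀ + (j : ℕ))) x'‖ = |α j| * ‖x'‖ := by
      rw [h2, abs_mul, abs_inv, abs_norm]
      field_simp
    rw [h3] at h1
    exact (le_of_mul_le_mul_right h1 hn).trans hCf
end
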